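/- arXiv:1805.09437 — 2 statements merged into one kernel-verified Lean document; each statement's English description precedes it below -/
import Mathlib

section
/- Coherence of the successor-tree construction: for an unprovable hypersequent H, with T, λ, and S(H) as in the tree construction, the following hold: (1) T is a tree (closed under initial segments in the successor order); (2) every G ∈ S(H) is unprovable in cut-free RK and fully reduced; (3) if G = λ(σ), then a label τ occurs in G iff R*τσ; (4) if G = λ(σ), G' = λ(τ), and R⁺τσ, then G(τ) = G'(τ); (5) if G, G' ∈ S(H) and τ occurs in both, then G(τ) = G'(τ); (6) if G | Γ ⇒[σ] Δ | G' ∈ S(H) and □φ ∈ Δ, there is τ ∈ T with Rστ and a hypersequent G | Γ ⇒[σ] Δ | Γ' ⇒[τ] Δ' ∈ S(H) with φ ∈ Δ'. -/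
/-- Modal formulas: atoms, negation, conjunction, box. -/
inductive MF : Type
  | atom : ℕ → MF
  | neg : MF → MF
  | conj : MF → MF → MF
  | box : MF → MF

/-- A sequent: a pair of finite multisets of modal formulas. -/
structure Seqt : Type where
  ant : Multiset MF
  suc : Multiset MF

/-- The empty sequent. -/
def Seqt.empty : Seqt := ⟨0, 0⟩

/-- A hypersequent: a (nonempty, enforced in theorems) sequence of sequents. -/
abbrev Hyperseq := List Seqt

/-- A Kripke model. -/
structure KModel : Type 1 where
  W : Type
  R : W → W → Prop
  V : ℕ → W → Prop

/-- Satisfaction of a modal formula at a world. -/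
def KModel.sat (M : KModel) : M.W → MF → Prop
  | w, .atom n => M.V n w
  | w, .neg φ => ¬ M.sat w φ
  | w, .conj φ ψ => M.sat w φ ∧ M.sat w ψ
  | w, .box φ => ∀ v, M.R w v → M.sat v φ

/-- `M` is a countermodel to sequent `S` at world `w`. -/
def Countermodel (M : KModel) (w : M.W) (S : Seqt) : Prop :=
  (∀ φ ∈ S.ant, M.sat w φ) ∧ (∀ φ ∈ S.suc, ¬ M.sat w φ)

/-- `M` is a counter-example to hypersequent `H`: there is a branch of worlds
(consecutive worlds related by `R`) falsifying the components pointwise. -/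
def CounterExample (M : KModel) (H : Hyperseq) : Prop :=
  ∃ ws : List M.W, List.Chain' M.R ws ∧
    List.Forall₂ (fun S w => Countermodel M w S) H ws

/-- Which optional rules are present in a calculus (RK rules are always present). -/
structure RuleSet : Type where
  cut : Bool := false
  ec : Bool := false
  ew : Bool := false
  ee : Bool := false
  drop : Bool := false
  sym : Bool := false

/-- Derivability in a relational hypersequent calculus: the rules of RK
(axioms, internal weakening/contraction, EWL/EWR, rules for ¬, ∧, □),
plus cut and the external structural rules EC, EW, EE, Drop, Sym when enabled. -/
inductive Deriv (ρ : RuleSet) : Hyperseq → Prop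
  | ax (φ : MF) : Deriv ρ [⟨{φ}, {φ}⟩]
  | wl (G H : Hyperseq) (Γ Δ : Multiset MF) (φ : MF) :
      Deriv ρ (G ++ ⟨Γ, Δ⟩ :: H) → Deriv ρ (G ++ ⟨φ ::ₘ Γ, Δ⟩ :: H)
  | wr (G H : Hyperseq) (Γ Δ : Multiset MF) (φ : MF) :
      Deriv ρ (G ++ ⟨Γ, Δ⟩ :: H) → Deriv ρ (G ++ ⟨Γ, φ ::ₘ Δ⟩ :: H)
  | cl (G H : Hyperseq) (Γ Δ : Multiset MF) (φ : MF) :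
      Deriv ρ (G ++ ⟨φ ::ₘ φ ::ₘ Γ, Δ⟩ :: H) → Deriv ρ (G ++ ⟨φ ::ₘ Γ, Δ⟩ :: H)
  | cr (G H : Hyperseq) (Γ Δ : Multiset MF) (φ : MF) :
      Deriv ρ (G ++ ⟨Γ, φ ::ₘ φ ::ₘ Δ⟩ :: H) → Deriv ρ (G ++ ⟨Γ, φ ::ₘ Δ⟩ :: H)
  | cut (hρ : ρ.cut = true) (G H : Hyperseq) (Γ Δ Λ Θ : Multiset MF) (φ : MF) :
      Deriv ρ (G ++ ⟨Γ, φ ::ₘ Δ⟩ :: H) → Deriv ρ (G ++ ⟨φ ::ₘ Λ, Θ⟩ :: H) →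
      Deriv ρ (G ++ ⟨Γ + Λ, Δ + Θ⟩ :: H)
  | ewr (G : Hyperseq) : Deriv ρ G → Deriv ρ (G ++ [Seqt.empty])
  | ewl (G : Hyperseq) : Deriv ρ G → Deriv ρ (Seqt.empty :: G)
  | negL (G H : Hyperseq) (Γ Δ : Multiset MF) (φ : MF) :
      Deriv ρ (G ++ ⟨Γ, φ ::ₘ Δ⟩ :: H) → Deriv ρ (G ++ ⟨.neg φ ::ₘ Γ, Δ⟩ :: H)
  | negR (G H : Hyperseq) (Γ Δ : Multiset MF) (φ : MF) :
      Deriv ρ (G ++ ⟨φ ::ₘ Γ, Δ⟩ :: H) → Deriv ρ (G ++ ⟨Γ, .neg φ ::ₘ Δ⟩ :: H)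
  | andL1 (G H : Hyperseq) (Γ Δ : Multiset MF) (φ ψ : MF) :
      Deriv ρ (G ++ ⟨φ ::ₘ Γ, Δ⟩ :: H) → Deriv ρ (G ++ ⟨.conj φ ψ ::ₘ Γ, Δ⟩ :: H)
  | andL2 (G H : Hyperseq) (Γ Δ : Multiset MF) (φ ψ : MF) :
      Deriv ρ (G ++ ⟨ψ ::ₘ Γ, Δ⟩ :: H) → Deriv ρ (G ++ ⟨.conj φ ψ ::ₘ Γ, Δ⟩ :: H)
  | andR (G H : Hyperseq) (Γ Δ : Multiset MF) (φ ψ : MF) :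
      Deriv ρ (G ++ ⟨Γ, φ ::ₘ Δ⟩ :: H) → Deriv ρ (G ++ ⟨Γ, ψ ::ₘ Δ⟩ :: H) →
      Deriv ρ (G ++ ⟨Γ, .conj φ ψ ::ₘ Δ⟩ :: H)
  | boxL (G H : Hyperseq) (Γ Δ Λ Θ : Multiset MF) (φ : MF) :
      Deriv ρ (G ++ ⟨Γ, Δ⟩ :: ⟨φ ::ₘ Λ, Θ⟩ :: H) →
      Deriv ρ (G ++ ⟨.box φ ::ₘ Γ, Δ⟩ :: ⟨Λ, Θ⟩ :: H)
  | boxR (G : Hyperseq) (Γ Δ : Multiset MF) (φ : MF) :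
      Deriv ρ (G ++ [⟨Γ, Δ⟩, ⟨0, {φ}⟩]) → Deriv ρ (G ++ [⟨Γ, .box φ ::ₘ Δ⟩])
  | ec (hρ : ρ.ec = true) (G H : Hyperseq) (S : Seqt) :
      Deriv ρ (G ++ S :: S :: H) → Deriv ρ (G ++ S :: H)
  | ew (hρ : ρ.ew = true) (G H : Hyperseq) :
      Deriv ρ (G ++ H) → Deriv ρ (G ++ Seqt.empty :: H)
  | ee (hρ : ρ.ee = true) (G H : Hyperseq) (S S' : Seqt) :
      Deriv ρ (G ++ S :: S' :: H) → Deriv ρ (G ++ S' :: S :: H)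
  | drop (hρ : ρ.drop = true) (G : Hyperseq) :
      Deriv ρ (G ++ [Seqt.empty]) → Deriv ρ G
  | symm (hρ : ρ.sym = true) (G : Hyperseq) : Deriv ρ G → Deriv ρ G.reverse

/-- Labels: finite sequences of natural numbers. -/
abbrev Label := List ℕ

/-- Labelled hypersequents: sequences of labelled sequents. -/
abbrev LHyp := List (Label × Seqt)

/-- The successor order on labels: `RLab σ τ` iff `τ = σ.n` for some `n`. -/
def RLab (σ τ : Label) : Prop := ∃ n : ℕ, τ = σ ++ [n]

/-- A labelled hypersequent: nonempty, and its labels form a branch under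
the successor order. -/
def IsLabelled (L : LHyp) : Prop :=
  L ≠ [] ∧ List.Chain' (fun a b => RLab a.1 b.1) L

/-- Cut-free RK: no cut, and none of the optional external structural rules. -/
def cfRK : RuleSet := {}

/-- A labelled hypersequent is provable iff its underlying hypersequent is derivable. -/
def LProvable (ρ : RuleSet) (L : LHyp) : Prop := Deriv ρ (L.map Prod.snd)

/-- `comp L σ`: the rightmost `σ`-labelled component of `L`
(the empty sequent if there is none). -/
def comp (L : LHyp) (σ : Label) : Seqt :=
  (((L.reverse.find? (fun p => p.1 == σ)).map Prod.snd).getD Seqt.empty)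

/-- The `σ`-reduct relation on labelled hypersequents, corresponding to the rules
¬L, ¬R, ∧L, ∧R and □L.  A reduction is applicable only if it adds new material
(otherwise the reduct is identical to the original hypersequent); for ∧R, the
reduct adds the left conjunct if the result is unprovable, otherwise the right. -/
inductive Reduct (ρ : RuleSet) (σ : Label) : LHyp → LHyp → Prop
  | negL (G G' : LHyp) (Γ Δ : Multiset MF) (φ : MF) (h : φ ∉ Δ) :
      Reduct ρ σ (G ++ (σ, ⟨.neg φ ::ₘ Γ, Δ⟩) :: G')
                 (G ++ (σ, ⟨.neg φ ::ₘ Γ, φ ::ₘ Δ⟩) :: G')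
  | negR (G G' : LHyp) (Γ Δ : Multiset MF) (φ : MF) (h : φ ∉ Γ) :
      Reduct ρ σ (G ++ (σ, ⟨Γ, .neg φ ::ₘ Δ⟩) :: G')
                 (G ++ (σ, ⟨φ ::ₘ Γ, .neg φ ::ₘ Δ⟩) :: G')
  | andL (G G' : LHyp) (Γ Δ : Multiset MF) (φ ψ : MF) (h : ¬ (φ ∈ Γ ∧ ψ ∈ Γ)) :
      Reduct ρ σ (G ++ (σ, ⟨.conj φ ψ ::ₘ Γ, Δ⟩) :: G')
                 (G ++ (σ, ⟨φ ::ₘ ψ ::ₘ .conj φ ψ ::ₘ Γ, Δ⟩) :: G')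
  | andR1 (G G' : LHyp) (Γ Δ : Multiset MF) (φ ψ : MF) (h : φ ∉ Δ ∧ ψ ∉ Δ)
      (hunp : ¬ LProvable ρ (G ++ (σ, ⟨Γ, φ ::ₘ .conj φ ψ ::ₘ Δ⟩) :: G')) :
      Reduct ρ σ (G ++ (σ, ⟨Γ, .conj φ ψ ::ₘ Δ⟩) :: G')
                 (G ++ (σ, ⟨Γ, φ ::ₘ .conj φ ψ ::ₘ Δ⟩) :: G')
  | andR2 (G G' : LHyp) (Γ Δ : Multiset MF) (φ ψ : MF) (h : φ ∉ Δ ∧ ψ ∉ Δ)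
      (hprov : LProvable ρ (G ++ (σ, ⟨Γ, φ ::ₘ .conj φ ψ ::ₘ Δ⟩) :: G')) :
      Reduct ρ σ (G ++ (σ, ⟨Γ, .conj φ ψ ::ₘ Δ⟩) :: G')
                 (G ++ (σ, ⟨Γ, ψ ::ₘ .conj φ ψ ::ₘ Δ⟩) :: G')
  | boxL (G G' : LHyp) (σ' : Label) (Γ' Δ' Γ Δ : Multiset MF) (φ : MF) (h : φ ∉ Γ) :
      Reduct ρ σ (G ++ (σ', ⟨.box φ ::ₘ Γ', Δ'⟩) :: (σ, ⟨Γ, Δ⟩) :: G')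
                 (G ++ (σ', ⟨.box φ ::ₘ Γ', Δ'⟩) :: (σ, ⟨φ ::ₘ Γ, Δ⟩) :: G')

/-- `L` is `σ`-reduced: it is identical to all of its `σ`-reducts. -/
def Reduced (ρ : RuleSet) (σ : Label) (L : LHyp) : Prop :=
  ∀ L', Reduct ρ σ L L' → L' = L

/-- `L` is fully reduced: `σ`-reduced for every label `σ`. -/
def FullyReduced (ρ : RuleSet) (L : LHyp) : Prop := ∀ σ, Reduced ρ σ L

/-- One reduction step (at some label). -/
def ReductStep (ρ : RuleSet) (A B : LHyp) : Prop := ∃ σ, Reduct ρ σ A B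

/-- `L'` is a full reduction of `L`: obtained from `L` by a finite sequence of
reductions, and fully reduced. -/
def IsFullReduction (ρ : RuleSet) (L L' : LHyp) : Prop :=
  Relation.ReflTransGen (ReductStep ρ) L L' ∧ FullyReduced ρ L'

/-- `S'` extends `S`: antecedent and succedent are multiset-contained. -/
def Seqt.Ext (S' S : Seqt) : Prop := S.ant ≤ S'.ant ∧ S.suc ≤ S'.suc

/-- `L'` extends `L`: for every label of `L`, the rightmost `σ`-component of `L'`
extends that of `L`. -/
def LExtends (L' L : LHyp) : Prop :=
  ∀ σ ∈ L.map Prod.fst, Seqt.Ext (comp L' σ) (comp L σ)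

/-- The initial labelling of a hypersequent: the `i`-th component gets label
`0…0` (`i` zeros), so that the labels form a branch under the successor order. -/
def initLab (H : Hyperseq) : LHyp := H.mapIdx (fun i S => (List.replicate i 0, S))

theorem Deriv.append_right {ρ : RuleSet} {G : Hyperseq} (h : Deriv ρ G) (K : Hyperseq) :
    Deriv ρ (G ++ K) := by
  induction K generalizing G with
  | nil => simpa using h
  | cons S K ih =>
    have hl : ∀ Γ : Multiset MF, Deriv ρ (G ++ [⟨Γ, 0⟩]) := by
      intro Γ
      induction Γ using Multiset.induction_on with
      | empty => exact h.ewr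
      | cons φ Γ ih => exact .wl _ _ _ _ _ ih
    have hr : ∀ Δ : Multiset MF, Deriv ρ (G ++ [⟨S.ant, Δ⟩]) := by
      intro Δ
      induction Δ using Multiset.induction_on with
      | empty => exact hl _
      | cons φ Δ ih => exact .wr _ _ _ _ _ ih
    simpa using ih (hr S.suc)

namespace Reduct

variable {ρ : RuleSet} {σ : Label} {A B : LHyp}

theorem map_fst (h : Reduct ρ σ A B) : B.map Prod.fst = A.map Prod.fst := by
  cases h <;> simp

theorem ne (h : Reduct ρ σ A B) : B ≠ A := by
  cases h <;> intro h <;> simpa [add_assoc] using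
    congrArg (List.map fun p => p.2.ant.card + p.2.suc.card) h

theorem lProvable (h : Reduct ρ σ A B) (hB : LProvable ρ B) : LProvable ρ A := by
  unfold LProvable at *
  cases h with
  | negL G G' Γ Δ φ _ =>
    simp only [List.map_append, List.map_cons] at *
    exact .cl _ _ _ _ _ (.negL _ _ _ _ _ hB)
  | negR G G' Γ Δ φ _ =>
    simp only [List.map_append, List.map_cons] at *
    exact .cr _ _ _ _ _ (.negR _ _ _ _ _ hB)
  | andL G G' Γ Δ φ ψ _ =>
    simp only [List.map_append, List.map_cons] at *
    have h1 := Deriv.andL1 _ _ _ _ _ ψ hB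
    rw [Multiset.cons_swap] at h1
    exact .cl _ _ _ _ _ (.cl _ _ _ _ _ (.andL2 _ _ _ _ φ _ h1))
  | andR1 G G' Γ Δ φ ψ _ hunp => exact absurd hB hunp
  | andR2 G G' Γ Δ φ ψ _ hprov =>
    unfold LProvable at hprov
    simp only [List.map_append, List.map_cons] at *
    exact .cr _ _ _ _ _ (.andR _ _ _ _ _ _ hprov hB)
  | boxL G G' σ' Γ' Δ' Γ Δ φ _ =>
    simp only [List.map_append, List.map_cons] at *
    exact .cl _ _ _ _ _ (.boxL _ _ _ _ _ _ _ hB)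

theorem exists_andR (ρ : RuleSet) (σ : Label) (G G' : LHyp) (Γ Δ : Multiset MF) (φ ψ : MF)
    (h : φ ∉ Δ ∧ ψ ∉ Δ) :
    ∃ B, Reduct ρ σ (G ++ (σ, ⟨Γ, .conj φ ψ ::ₘ Δ⟩) :: G') B := by
  by_cases hp : LProvable ρ (G ++ (σ, ⟨Γ, φ ::ₘ .conj φ ψ ::ₘ Δ⟩) :: G')
  · exact ⟨_, .andR2 _ _ _ _ _ _ h hp⟩
  · exact ⟨_, .andR1 _ _ _ _ _ _ h hp⟩

theorem exists_append_right (h : Reduct ρ σ A B) (C : LHyp) : ∃ D, Reduct ρ σ (A ++ C) D := by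
  cases h <;> simp only [List.append_assoc, List.cons_append]
  case negL h => exact ⟨_, .negL _ _ _ _ _ h⟩
  case negR h => exact ⟨_, .negR _ _ _ _ _ h⟩
  case andL h => exact ⟨_, .andL _ _ _ _ _ _ h⟩
  case andR1 h _ => exact exists_andR _ _ _ _ _ _ _ _ h
  case andR2 h _ => exact exists_andR _ _ _ _ _ _ _ _ h
  case boxL h => exact ⟨_, .boxL _ _ _ _ _ _ _ _ h⟩

/-- A reduction of `L ++ [x]` either acts on the last component or yields one of `L`. -/
theorem concat_cases {L : LHyp} {x : Label × Seqt} (h : Reduct ρ σ (L ++ [x]) B) :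
    (∃ y : Label × Seqt, B = L ++ [y] ∧ y.1 = x.1 ∧ x.2.suc ⊆ y.2.suc) ∨
      ∃ L', Reduct ρ σ L L' := by
  generalize hA : L ++ [x] = A at h
  cases h with
  | negL G G' Γ Δ φ h =>
    rcases List.eq_nil_or_concat' G' with rfl | ⟨K, z, rfl⟩
    · obtain ⟨rfl, rfl⟩ := by simpa using List.append_inj' hA rfl
      exact .inl ⟨_, rfl, rfl, Multiset.subset_cons _ _⟩
    · rw [← List.cons_append, ← List.append_assoc] at hA
      obtain ⟨rfl, -⟩ := List.append_inj' hA rfl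
      exact .inr ⟨_, .negL _ _ _ _ _ h⟩
  | negR G G' Γ Δ φ h =>
    rcases List.eq_nil_or_concat' G' with rfl | ⟨K, z, rfl⟩
    · obtain ⟨rfl, rfl⟩ := by simpa using List.append_inj' hA rfl
      exact .inl ⟨_, rfl, rfl, Multiset.Subset.refl _⟩
    · rw [← List.cons_append, ← List.append_assoc] at hA
      obtain ⟨rfl, -⟩ := List.append_inj' hA rfl
      exact .inr ⟨_, .negR _ _ _ _ _ h⟩
  | andL G G' Γ Δ φ ψ h =>
    rcases List.eq_nil_or_concat' G' with rfl | ⟨K, z, rfl⟩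
    · obtain ⟨rfl, rfl⟩ := by simpa using List.append_inj' hA rfl
      exact .inl ⟨_, rfl, rfl, Multiset.Subset.refl _⟩
    · rw [← List.cons_append, ← List.append_assoc] at hA
      obtain ⟨rfl, -⟩ := List.append_inj' hA rfl
      exact .inr ⟨_, .andL _ _ _ _ _ _ h⟩
  | andR1 G G' Γ Δ φ ψ h _ =>
    rcases List.eq_nil_or_concat' G' with rfl | ⟨K, z, rfl⟩
    · obtain ⟨rfl, rfl⟩ := by simpa using List.append_inj' hA rfl
      exact .inl ⟨_, rfl, rfl, Multiset.subset_cons _ _⟩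
    · rw [← List.cons_append, ← List.append_assoc] at hA
      obtain ⟨rfl, -⟩ := List.append_inj' hA rfl
      exact .inr (exists_andR _ _ _ _ _ _ _ _ h)
  | andR2 G G' Γ Δ φ ψ h _ =>
    rcases List.eq_nil_or_concat' G' with rfl | ⟨K, z, rfl⟩
    · obtain ⟨rfl, rfl⟩ := by simpa using List.append_inj' hA rfl
      exact .inl ⟨_, rfl, rfl, Multiset.subset_cons _ _⟩
    · rw [← List.cons_append, ← List.append_assoc] at hA
      obtain ⟨rfl, -⟩ := List.append_inj' hA rfl
      exact .inr (exists_andR _ _ _ _ _ _ _ _ h)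
  | boxL G G' σ' Γ' Δ' Γ Δ φ h =>
    rcases List.eq_nil_or_concat' G' with rfl | ⟨K, z, rfl⟩
    · rw [List.append_cons G] at hA
      rw [List.append_cons G]
      obtain ⟨rfl, hx⟩ := List.append_inj' hA rfl
      obtain rfl := List.singleton_inj.1 hx
      exact .inl ⟨_, rfl, rfl, Multiset.Subset.refl _⟩
    · rw [← List.cons_append, ← List.cons_append, ← List.append_assoc] at hA
      obtain ⟨rfl, -⟩ := List.append_inj' hA rfl
      exact .inr ⟨_, .boxL _ _ _ _ _ _ _ _ h⟩

end Reduct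

theorem FullyReduced.not_reduct {ρ : RuleSet} {L L' : LHyp} {σ : Label} (h : FullyReduced ρ L) :
    ¬ Reduct ρ σ L L' := fun hr => hr.ne (h σ L' hr)

theorem FullyReduced.of_append {ρ : RuleSet} {A C : LHyp} (h : FullyReduced ρ (A ++ C)) :
    FullyReduced ρ A := by
  intro σ B hB
  obtain ⟨D, hD⟩ := hB.exists_append_right C
  exact absurd hD h.not_reduct

namespace IsFullReduction

variable {ρ : RuleSet} {L L' : LHyp}

theorem map_fst (h : IsFullReduction ρ L L') : L'.map Prod.fst = L.map Prod.fst := by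
  obtain ⟨h, -⟩ := h
  induction h with
  | refl => rfl
  | tail _ hs ih => obtain ⟨σ, hs⟩ := hs; rw [hs.map_fst, ih]

theorem not_lProvable (h : IsFullReduction ρ L L') (hL : ¬ LProvable ρ L) : ¬ LProvable ρ L' := by
  obtain ⟨h, -⟩ := h
  induction h with
  | refl => exact hL
  | tail _ hs ih => obtain ⟨σ, hs⟩ := hs; exact fun hp => ih (hs.lProvable hp)

/-- Full reduction after appending a component to a fully reduced hypersequent changes only
the new component. -/
theorem exists_eq_concat {x : Label × Seqt} (h : IsFullReduction ρ (L ++ [x]) L')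
    (hL : FullyReduced ρ L) :
    ∃ S : Seqt, L' = L ++ [(x.1, S)] ∧ x.2.suc ⊆ S.suc := by
  obtain ⟨h, -⟩ := h
  induction h with
  | refl => exact ⟨x.2, rfl, Multiset.Subset.refl _⟩
  | tail _ hs ih =>
    obtain ⟨S, rfl, hS⟩ := ih
    obtain ⟨σ, hs⟩ := hs
    rcases hs.concat_cases with ⟨y, rfl, hy, hsub⟩ | ⟨K, hK⟩
    · exact ⟨y.2, by rw [← hy], Multiset.Subset.trans hS hsub⟩
    · exact absurd hK hL.not_reduct

end IsFullReduction

theorem reflTransGen_rLab_iff {τ σ : Label} :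
    Relation.ReflTransGen RLab τ σ ↔ τ <+: σ := by
  constructor
  · intro h
    induction h with
    | refl => exact List.prefix_rfl
    | tail _ hs ih => obtain ⟨n, rfl⟩ := hs; exact ih.trans (List.prefix_append _ _)
  · rintro ⟨u, rfl⟩
    induction u using List.reverseRecOn with
    | nil => simpa using Relation.ReflTransGen.refl
    | append_singleton u n ih => exact ih.tail ⟨n, by simp⟩

theorem List.inits_concat {α : Type*} (l : List α) (a : α) :
    (l ++ [a]).inits = l.inits ++ [l ++ [a]] := by
  induction l with
  | nil => simp
  | cons b l ih => simp [ih]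

theorem List.nodup_inits {α : Type*} (l : List α) : l.inits.Nodup := by
  induction l with
  | nil => simp
  | cons b l ih => simpa using ih.map (List.cons_injective)

theorem isLabelled_of_map_fst_eq_inits {L : LHyp} {σ : Label} (h : L.map Prod.fst = σ.inits) :
    IsLabelled L := by
  have hc : σ.inits.IsChain RLab := by
    clear h
    induction σ using List.reverseRecOn with
    | nil => simp
    | append_singleton σ n ih =>
      rw [List.inits_concat]
      refine ih.append (by simp) ?_
      intro x hx y hy
      have hlast : σ.inits.getLast? = some σ := by
        rcases List.eq_nil_or_concat' σ with rfl | ⟨K, z, rfl⟩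
        · simp
        · simp
      rw [hlast] at hx
      simp at hx hy
      exact ⟨n, by rw [← hx, ← hy]⟩
  refine ⟨?_, ?_⟩
  · rintro rfl
    simpa using congrArg List.length h
  · rw [← h, List.isChain_map] at hc
    exact hc

theorem comp_concat_self (L : LHyp) (σ : Label) (S : Seqt) : comp (L ++ [(σ, S)]) σ = S := by
  simp [comp]

theorem comp_append_of_notMem {L K : LHyp} {τ : Label} (h : τ ∉ K.map Prod.fst) :
    comp (L ++ K) τ = comp L τ := by
  have hn : K.reverse.find? (fun p => p.1 == τ) = none := by
    rw [List.find?_eq_none]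
    intro p hp hpτ
    exact h (List.mem_map.2 ⟨p, List.mem_reverse.1 hp, by simpa using hpτ⟩)
  simp [comp, hn]

theorem eq_of_append_cons_eq_append_cons {K M G G' : LHyp} {σ : Label} {S S' : Seqt}
    (h : K ++ (σ, S') :: M = G ++ (σ, S) :: G')
    (hnd : ((G ++ (σ, S) :: G').map Prod.fst).Nodup) : K = G ∧ S' = S := by
  induction K generalizing G with
  | nil =>
    cases G with
    | nil => simp_all
    | cons g G =>
      obtain ⟨rfl, -⟩ := List.cons.inj h
      simp at hnd
  | cons x K ih =>
    cases G with
    | nil =>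
      obtain ⟨rfl, rfl⟩ := List.cons.inj h
      simp at hnd
    | cons g G =>
      obtain ⟨rfl, htail⟩ := List.cons.inj h
      obtain ⟨rfl, rfl⟩ := ih htail (List.nodup_cons.1 hnd).2
      exact ⟨rfl, rfl⟩

theorem map_fst_initLab (H : Hyperseq) :
    (initLab H).map Prod.fst = (List.range H.length).map fun i => List.replicate i 0 := by
  apply List.ext_getElem <;> simp [initLab]

theorem map_snd_initLab (H : Hyperseq) : (initLab H).map Prod.snd = H := by
  apply List.ext_getElem <;> simp [initLab]

theorem inits_replicate (n a : ℕ) :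
    (List.replicate n a).inits = (List.range (n + 1)).map fun i => List.replicate i a := by
  induction n with
  | zero => simp
  | succ n ih =>
    rw [List.replicate_succ', List.inits_concat, ih, List.range_succ (n := n + 1)]
    simp [List.replicate_succ']

theorem not_lProvable_concat_of_box {ρ : RuleSet} {G : LHyp} {σ τ : Label} {S : Seqt} {ψ : MF}
    (hG : ¬ LProvable ρ (G ++ [(σ, S)])) (hψ : MF.box ψ ∈ S.suc) :
    ¬ LProvable ρ (G ++ [(σ, S)] ++ [(τ, ⟨0, {ψ}⟩)]) := by
  intro hp
  obtain ⟨Γ, Δ⟩ := S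
  obtain ⟨Δ, rfl⟩ := Multiset.exists_cons_of_mem hψ
  apply hG
  unfold LProvable at *
  simp only [List.map_append, List.map_cons, List.map_nil, List.append_assoc,
    List.cons_append, List.nil_append] at *
  exact .cr _ [] _ _ _ (.boxR _ _ _ _ hp)

/-- Coherence of the successor-tree construction for an unprovable hypersequent `H`.
`Red` is a full-reduction operator, and `lam` (= λ) is the partial map assigning
labelled hypersequents to labels: on the spine it yields the initial segments of
the full reduction of the labelled version of `H`, and otherwise each defined value
`lam (σ.k)` is the full reduction of `lam σ` with a new component `⇒[σ.k] ψ`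
appended for a box formula `□ψ` in the succedent of the rightmost (σ-labelled)
component of `lam σ`; moreover every such box formula has a successor.
`T` is the domain of `lam` and `S(H)` its range.  Then:
(1) `T` is a tree; (2) every member of `S(H)` is unprovable in cut-free RK and
fully reduced; (3) a label `τ` occurs in `lam σ` iff `R* τ σ`; (4) if `R⁺ τ σ`
then `lam σ` and `lam τ` have the same τ-component; (5) any two members of `S(H)`
agree on the components of a common label; (6) if `G | Γ ⇒[σ] Δ | G' ∈ S(H)` and
`□φ ∈ Δ`, there are `τ` with `R σ τ` and `G | Γ ⇒[σ] Δ | Γ' ⇒[τ] Δ' ∈ S(H)`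
with `φ ∈ Δ'`. -/
theorem tree_construction
    (H : Hyperseq) (hne : H ≠ []) (hH : ¬ Deriv cfRK H)
    (Red : LHyp → LHyp)
    (hRed : ∀ L, IsLabelled L → ¬ LProvable cfRK L → IsFullReduction cfRK L (Red L))
    (lam : Label → Option LHyp)
    (hspine : ∀ i < H.length,
      lam (List.replicate i 0) = some ((Red (initLab H)).take (i + 1)))
    (hdom : ∀ (σ : Label) (k : ℕ), lam (σ ++ [k]) ≠ none →
      (∃ i < H.length, σ ++ [k] = List.replicate i 0) ∨
      (∃ (L : LHyp) (ψ : MF), lam σ = some L ∧ MF.box ψ ∈ (comp L σ).suc ∧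
        lam (σ ++ [k]) = some (Red (L ++ [(σ ++ [k], ⟨0, {ψ}⟩)]))))
    (hcomplete : ∀ (σ : Label) (L : LHyp) (ψ : MF), lam σ = some L →
      MF.box ψ ∈ (comp L σ).suc →
      ∃ k : ℕ, lam (σ ++ [k]) = some (Red (L ++ [(σ ++ [k], ⟨0, {ψ}⟩)]))) :
    -- (1) T is a tree
    (∀ (σ : Label) (k : ℕ), lam (σ ++ [k]) ≠ none → lam σ ≠ none) ∧
    -- (2) members of S(H) are unprovable and fully reduced
    (∀ (σ : Label) (L : LHyp), lam σ = some L →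
      ¬ LProvable cfRK L ∧ FullyReduced cfRK L) ∧
    -- (3) labels occurring in λ(σ) are exactly the R*-predecessors of σ
    (∀ (σ : Label) (L : LHyp), lam σ = some L →
      ∀ τ : Label, τ ∈ L.map Prod.fst ↔ Relation.ReflTransGen RLab τ σ) ∧
    -- (4) λ(σ) and λ(τ) agree on the τ-component when R⁺ τ σ
    (∀ (σ τ : Label) (L L' : LHyp), lam σ = some L → lam τ = some L' →
      Relation.TransGen RLab τ σ → comp L τ = comp L' τ) ∧
    -- (5) members of S(H) agree on components with a common label
    (∀ (σ σ' τ : Label) (L L' : LHyp), lam σ = some L → lam σ' = some L' →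
      τ ∈ L.map Prod.fst → τ ∈ L'.map Prod.fst → comp L τ = comp L' τ) ∧
    -- (6) box formulas in succedents have successor components
    (∀ (σ : Label) (G G' : LHyp) (S : Seqt) (φ : MF),
      (∃ ρ : Label, lam ρ = some (G ++ (σ, S) :: G')) → MF.box φ ∈ S.suc →
      ∃ (τ : Label) (S' : Seqt), RLab σ τ ∧ φ ∈ S'.suc ∧
        ∃ ρ : Label, lam ρ = some (G ++ [(σ, S), (τ, S')])) := by
  have hnodup : ∀ {σ : Label} {L : LHyp}, L.map Prod.fst = σ.inits → (L.map Prod.fst).Nodup :=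
    fun h => h ▸ List.nodup_inits _
  have hinit : IsFullReduction cfRK (initLab H) (Red (initLab H)) := by
    have hlast : (initLab H).map Prod.fst = (List.replicate (H.length - 1) 0).inits := by
      rw [map_fst_initLab, inits_replicate, Nat.sub_add_cancel (List.length_pos_iff.2 hne)]
    exact hRed _ (isLabelled_of_map_fst_eq_inits hlast)
      (by unfold LProvable; rwa [map_snd_initLab])
  have hinit_unp : ¬ LProvable cfRK (Red (initLab H)) :=
    hinit.not_lProvable (by unfold LProvable; rwa [map_snd_initLab])
  have hspine_good : ∀ i < H.length,
      ((Red (initLab H)).take (i + 1)).map Prod.fst = (List.replicate i 0).inits ∧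
      ¬ LProvable cfRK ((Red (initLab H)).take (i + 1)) ∧
      FullyReduced cfRK ((Red (initLab H)).take (i + 1)) := by
    intro i hi
    refine ⟨?_, ?_, ?_⟩
    · rw [List.map_take, hinit.map_fst, map_fst_initLab, inits_replicate, ← List.map_take,
        List.take_range, Nat.min_eq_left hi]
    · intro hp
      apply hinit_unp
      have := Deriv.append_right hp (((Red (initLab H)).drop (i + 1)).map Prod.snd)
      rwa [← List.map_append, List.take_append_drop] at this
    · apply FullyReduced.of_append (C := (Red (initLab H)).drop (i + 1))
      rw [List.take_append_drop]
      exact hinit.2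
  have hsucc : ∀ (σ : Label) (k : ℕ) (L : LHyp) (ψ : MF), L.map Prod.fst = σ.inits →
      ¬ LProvable cfRK L → FullyReduced cfRK L → MF.box ψ ∈ (comp L σ).suc →
      ¬ LProvable cfRK (Red (L ++ [(σ ++ [k], ⟨0, {ψ}⟩)])) ∧
      FullyReduced cfRK (Red (L ++ [(σ ++ [k], ⟨0, {ψ}⟩)])) ∧
      ∃ S : Seqt, Red (L ++ [(σ ++ [k], ⟨0, {ψ}⟩)]) = L ++ [(σ ++ [k], S)] ∧ ψ ∈ S.suc := by
    intro σ k L ψ hL hunp hfull hψ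
    have hlab : IsLabelled (L ++ [(σ ++ [k], (⟨0, {ψ}⟩ : Seqt))]) := by
      apply isLabelled_of_map_fst_eq_inits (σ := σ ++ [k])
      simp [hL]
    have hunp' : ¬ LProvable cfRK (L ++ [(σ ++ [k], (⟨0, {ψ}⟩ : Seqt))]) := by
      rcases List.eq_nil_or_concat' L with rfl | ⟨G, ⟨σ', S⟩, rfl⟩
      · simp [comp, Seqt.empty] at hψ
      · have hσ : σ' = σ := by
          rcases List.eq_nil_or_concat' σ with rfl | ⟨K, z, rfl⟩
          · simpa using congrArg List.getLast? hL
          · simpa using congrArg List.getLast? hL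
        subst hσ
        rw [comp_concat_self] at hψ
        exact not_lProvable_concat_of_box hunp hψ
    have hred := hRed _ hlab hunp'
    obtain ⟨S, hS, hsub⟩ := hred.exists_eq_concat hfull
    exact ⟨hred.not_lProvable hunp', hred.2, S, hS, hsub (by simp)⟩
  have hgood : ∀ (σ : Label) (L : LHyp), lam σ = some L →
      L.map Prod.fst = σ.inits ∧ ¬ LProvable cfRK L ∧ FullyReduced cfRK L := by
    intro σ
    induction σ using List.reverseRecOn with
    | nil =>
      intro L hL
      have h0 := List.length_pos_iff.2 hne
      have h := hspine 0 h0
      rw [List.replicate_zero, hL] at h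
      obtain rfl := Option.some.inj h
      exact hspine_good 0 h0
    | append_singleton σ k ih =>
      intro L' hL'
      rcases hdom σ k (by simp [hL']) with ⟨i, hi, hσ⟩ | ⟨L, ψ, hL, hψ, h⟩
      · rw [hσ, hspine i hi] at hL'
        obtain rfl := Option.some.inj hL'
        rw [hσ]
        exact hspine_good i hi
      · obtain ⟨hfst, hunp, hfull⟩ := ih L hL
        obtain ⟨hunp', hfull', S, hS, -⟩ := hsucc σ k L ψ hfst hunp hfull hψ
        rw [hL'] at h
        obtain rfl := Option.some.inj h
        refine ⟨?_, hunp', hfull'⟩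
        simp [hS, hfst]
  have hpred : ∀ (σ : Label) (k : ℕ) (L' : LHyp), lam (σ ++ [k]) = some L' →
      ∃ L, lam σ = some L ∧ L <+: L' := by
    intro σ k L' hL'
    rcases hdom σ k (by simp [hL']) with ⟨i, hi, hσ⟩ | ⟨L, ψ, hL, hψ, h⟩
    · obtain _ | i := i
      · simp at hσ
      · rw [hσ, hspine _ hi] at hL'
        obtain rfl := Option.some.inj hL'
        rw [List.replicate_succ'] at hσ
        obtain ⟨rfl, -⟩ := List.append_inj' hσ rfl
        exact ⟨_, hspine i (by omega), List.take_prefix_take_left (by omega)⟩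
    · obtain ⟨hfst, hunp, hfull⟩ := hgood σ L hL
      obtain ⟨-, -, S, hS, -⟩ := hsucc σ k L ψ hfst hunp hfull hψ
      rw [hL'] at h
      obtain rfl := Option.some.inj h
      exact ⟨L, hL, hS ▸ List.prefix_append _ _⟩
  have hprefix : ∀ (τ u : Label) (L : LHyp), lam (τ ++ u) = some L →
      ∃ L', lam τ = some L' ∧ L' <+: L := by
    intro τ u
    induction u using List.reverseRecOn with
    | nil => intro L hL; exact ⟨L, by simpa using hL, List.prefix_rfl⟩
    | append_singleton u k ih =>
      intro L hL
      rw [← List.append_assoc] at hL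
      obtain ⟨L₁, hL₁, hp₁⟩ := hpred _ _ _ hL
      obtain ⟨L₂, hL₂, hp₂⟩ := ih _ hL₁
      exact ⟨L₂, hL₂, hp₂.trans hp₁⟩
  have hcomp : ∀ (σ τ : Label) (L : LHyp), lam σ = some L → τ <+: σ →
      ∃ L', lam τ = some L' ∧ comp L τ = comp L' τ := by
    rintro _ τ L hL ⟨u, rfl⟩
    obtain ⟨L', hL', K, rfl⟩ := hprefix τ u L hL
    refine ⟨L', hL', comp_append_of_notMem fun hK => ?_⟩
    have hnd := hnodup (hgood _ _ hL).1
    rw [List.map_append] at hnd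
    refine (List.nodup_append.1 hnd).2.2 τ ?_ τ hK rfl
    rw [(hgood _ _ hL').1]
    simp
  refine ⟨?_, fun σ L hL => (hgood σ L hL).2, ?_, ?_, ?_, ?_⟩
  · intro σ k h
    obtain ⟨L', hL'⟩ := Option.ne_none_iff_exists'.1 h
    obtain ⟨L, hL, -⟩ := hpred σ k L' hL'
    simp [hL]
  · intro σ L hL τ
    rw [(hgood σ L hL).1, List.mem_inits, reflTransGen_rLab_iff]
  · intro σ τ L L' hL hL' hτ
    obtain ⟨K, hK, h⟩ := hcomp σ τ L hL (reflTransGen_rLab_iff.1 hτ.to_reflTransGen)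
    rw [h, Option.some.inj (hK.symm.trans hL')]
  · intro σ σ' τ L L' hL hL' hτ hτ'
    rw [(hgood _ _ hL).1, List.mem_inits] at hτ
    rw [(hgood _ _ hL').1, List.mem_inits] at hτ'
    obtain ⟨K, hK, h⟩ := hcomp σ τ L hL hτ
    obtain ⟨K', hK', h'⟩ := hcomp σ' τ L' hL' hτ'
    rw [h, h', Option.some.inj (hK.symm.trans hK')]
  · rintro σ G G' S φ ⟨ρ, hρ⟩ hφ
    have hfst := (hgood ρ _ hρ).1
    have hnd := hnodup hfst
    have hσ : σ <+: ρ := by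
      rw [← List.mem_inits, ← hfst]
      simp
    obtain ⟨u, rfl⟩ := hσ
    obtain ⟨L, hL, hpre⟩ := hprefix σ u _ hρ
    have hLfst := (hgood σ L hL).1
    have hLeq : L = G ++ [(σ, S)] := by
      rcases List.eq_nil_or_concat' L with rfl | ⟨K, ⟨σ', S'⟩, rfl⟩
      · simpa using congrArg List.length hLfst
      · have hσ' : σ' = σ := by
          rcases List.eq_nil_or_concat' σ with rfl | ⟨K, z, rfl⟩
          · simpa using congrArg List.getLast? hLfst
          · simpa using congrArg List.getLast? hLfst
        subst hσ'
        obtain ⟨M, hM⟩ := hpre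
        rw [← List.append_cons] at hM
        obtain ⟨rfl, rfl⟩ := eq_of_append_cons_eq_append_cons hM hnd
        rfl
    subst hLeq
    obtain ⟨hLfst, hunp, hfull⟩ := hgood σ _ hL
    have hφ' : MF.box φ ∈ (comp (G ++ [(σ, S)]) σ).suc := by rwa [comp_concat_self]
    obtain ⟨k, hk⟩ := hcomplete σ _ φ hL hφ'
    obtain ⟨-, -, S', hS', hmem⟩ := hsucc σ k _ φ hLfst hunp hfull hφ'
    refine ⟨σ ++ [k], S', ⟨k, rfl⟩, hmem, σ ++ [k], ?_⟩
    rw [hk, hS']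
    simp
end

section
/- Cut-free completeness of RK: if a hypersequent H is not provable in cut-free RK, then there is a Kripke model that is a counter-example to H; equivalently, every hypersequent valid over the class of all Kripke frames is provable in RK without the cut rule. -/
/-- Componentwise inclusion of the underlying sets of formulas. -/
def Seqt.Incl (S T : Seqt) : Prop := S.ant ⊆ T.ant ∧ S.suc ⊆ T.suc

namespace Deriv

variable {ρ : RuleSet}

theorem weaken_ant {G H : Hyperseq} {Γ Δ : Multiset MF} (Γ' : Multiset MF)
    (h : Deriv ρ (G ++ ⟨Γ, Δ⟩ :: H)) : Deriv ρ (G ++ ⟨Γ + Γ', Δ⟩ :: H) := by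
  induction Γ' using Multiset.induction_on with
  | empty => simpa using h
  | cons a s ih => rw [Multiset.add_cons]; exact wl _ _ _ _ _ ih

theorem weaken_suc {G H : Hyperseq} {Γ Δ : Multiset MF} (Δ' : Multiset MF)
    (h : Deriv ρ (G ++ ⟨Γ, Δ⟩ :: H)) : Deriv ρ (G ++ ⟨Γ, Δ + Δ'⟩ :: H) := by
  induction Δ' using Multiset.induction_on with
  | empty => simpa using h
  | cons a s ih => rw [Multiset.add_cons]; exact wr _ _ _ _ _ ih

theorem contract_ant {G H : Hyperseq} {Γ Γ' Δ : Multiset MF} (hs : Γ ⊆ Γ')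
    (h : Deriv ρ (G ++ ⟨Γ + Γ', Δ⟩ :: H)) : Deriv ρ (G ++ ⟨Γ', Δ⟩ :: H) := by
  induction Γ using Multiset.induction_on with
  | empty => simpa using h
  | cons a s ih =>
    rw [Multiset.cons_subset] at hs
    refine ih hs.2 ?_
    obtain ⟨t, rfl⟩ := Multiset.exists_cons_of_mem hs.1
    rw [Multiset.cons_add, Multiset.add_cons] at h
    rw [Multiset.add_cons]
    exact cl _ _ _ _ _ h

theorem contract_suc {G H : Hyperseq} {Γ Δ Δ' : Multiset MF} (hs : Δ ⊆ Δ')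
    (h : Deriv ρ (G ++ ⟨Γ, Δ + Δ'⟩ :: H)) : Deriv ρ (G ++ ⟨Γ, Δ'⟩ :: H) := by
  induction Δ using Multiset.induction_on with
  | empty => simpa using h
  | cons a s ih =>
    rw [Multiset.cons_subset] at hs
    refine ih hs.2 ?_
    obtain ⟨t, rfl⟩ := Multiset.exists_cons_of_mem hs.1
    rw [Multiset.cons_add, Multiset.add_cons] at h
    rw [Multiset.add_cons]
    exact cr _ _ _ _ _ h

theorem incl_component {G H : Hyperseq} {S T : Seqt} (hs : S.Incl T)
    (h : Deriv ρ (G ++ S :: H)) : Deriv ρ (G ++ T :: H) :=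
  contract_suc hs.2 (weaken_suc _ (contract_ant hs.1 (weaken_ant _ h)))

theorem incl {H H' : Hyperseq} (hs : List.Forall₂ Seqt.Incl H H') (h : Deriv ρ H) :
    Deriv ρ H' := by
  suffices ∀ G, Deriv ρ (G ++ H) → Deriv ρ (G ++ H') from this [] h
  clear h
  induction hs with
  | nil => exact fun _ h => h
  | @cons S T A B hST _ ih =>
    intro G h
    have := ih (G ++ [T]) (by simpa using incl_component hST h)
    simpa using this

theorem append_right_s18 {G : Hyperseq} (h : Deriv ρ G) (K : Hyperseq) : Deriv ρ (G ++ K) := by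
  induction K generalizing G with
  | nil => simpa using h
  | cons S K ih =>
    have := ih (incl_component (T := S) ⟨Multiset.zero_subset _, Multiset.zero_subset _⟩
      (ewr G h))
    simpa using this

theorem append_left {G : Hyperseq} (h : Deriv ρ G) (K : Hyperseq) : Deriv ρ (K ++ G) := by
  induction K with
  | nil => exact h
  | cons S K ih =>
    exact incl_component (G := []) (T := S)
      ⟨Multiset.zero_subset _, Multiset.zero_subset _⟩ (ewl _ ih)

end Deriv

/-- A possibly infinite sequent: `(true, φ)` places `φ` in the antecedent, `(false, φ)` in the
succedent. -/
abbrev SignedSet : Type := Set (Bool × MF)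

/-- `S` is a finite part of the possibly infinite sequent `X`. -/
def Seqt.Sub (S : Seqt) (X : SignedSet) : Prop :=
  (∀ φ ∈ S.ant, (true, φ) ∈ X) ∧ (∀ φ ∈ S.suc, (false, φ) ∈ X)

/-- The formulas of a sequent, with their signs. -/
def Seqt.toSigned (S : Seqt) : SignedSet :=
  {x | x.1 = true ∧ x.2 ∈ S.ant ∨ x.1 = false ∧ x.2 ∈ S.suc}

theorem Seqt.Sub.mono {S : Seqt} {X Y : SignedSet} (h : S.Sub X) (hXY : X ⊆ Y) : S.Sub Y :=
  ⟨fun φ hφ => hXY (h.1 φ hφ), fun φ hφ => hXY (h.2 φ hφ)⟩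

theorem Seqt.sub_toSigned (S : Seqt) : S.Sub S.toSigned :=
  ⟨fun _ h => Or.inl ⟨rfl, h⟩, fun _ h => Or.inr ⟨rfl, h⟩⟩

theorem Seqt.toSigned_subset {S : Seqt} {X : SignedSet} (h : S.Sub X) : S.toSigned ⊆ X := by
  rintro ⟨b, φ⟩ (⟨hb, hφ⟩ | ⟨hb, hφ⟩) <;> simp only at hb hφ <;> subst hb
  exacts [h.1 φ hφ, h.2 φ hφ]

theorem Seqt.Sub.incl {S T : Seqt} (h : S.Sub T.toSigned) : S.Incl T := by
  constructor
  · intro φ hφ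
    simpa [Seqt.toSigned] using h.1 φ hφ
  · intro φ hφ
    simpa [Seqt.toSigned] using h.2 φ hφ

theorem Seqt.finite_toSigned (S : Seqt) : S.toSigned.Finite := by
  classical
  refine ((S.ant.toFinset.finite_toSet.image (Prod.mk true)).union
    (S.suc.toFinset.finite_toSet.image (Prod.mk false))).subset ?_
  rintro ⟨b, φ⟩ (⟨hb, hφ⟩ | ⟨hb, hφ⟩) <;> simp only at hb hφ <;> subst hb <;> simp [hφ]

theorem Seqt.empty_sub (X : SignedSet) : Seqt.empty.Sub X := by
  simp [Seqt.Sub, Seqt.empty]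

theorem exists_forall₂_sub (G : List SignedSet) : ∃ A, List.Forall₂ Seqt.Sub A G :=
  ⟨G.map fun _ => Seqt.empty,
    List.forall₂_map_left_iff.2 (List.forall₂_same.2 fun X _ => Seqt.empty_sub X)⟩

theorem exists_forall₂_sub_join {A B : Hyperseq} {G : List SignedSet}
    (hA : List.Forall₂ Seqt.Sub A G) (hB : List.Forall₂ Seqt.Sub B G) :
    ∃ C, List.Forall₂ Seqt.Sub C G ∧ List.Forall₂ Seqt.Incl A C ∧
      List.Forall₂ Seqt.Incl B C := by
  induction hA generalizing B with
  | nil => cases hB; exact ⟨[], .nil, .nil, .nil⟩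
  | @cons S X A G hS _ ih =>
    obtain _ | ⟨hT, hB⟩ := hB
    rename_i T B
    obtain ⟨C, h1, h2, h3⟩ := ih hB
    refine ⟨⟨S.ant + T.ant, S.suc + T.suc⟩ :: C, .cons ⟨?_, ?_⟩ h1, .cons ⟨?_, ?_⟩ h2,
      .cons ⟨?_, ?_⟩ h3⟩
    · intro φ h
      exact (Multiset.mem_add.1 h).elim (hS.1 φ) (hT.1 φ)
    · intro φ h
      exact (Multiset.mem_add.1 h).elim (hS.2 φ) (hT.2 φ)
    all_goals intro φ h; simp [h]

theorem exists_of_forall₂_append_cons {α β : Type*} {R : α → β → Prop} {H : List α}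
    {G K : List β} {X : β} (h : List.Forall₂ R H (G ++ X :: K)) :
    ∃ A S B, H = A ++ S :: B ∧ List.Forall₂ R A G ∧ R S X ∧ List.Forall₂ R B K := by
  induction G generalizing H with
  | nil =>
    obtain _ | ⟨h1, h2⟩ := h
    exact ⟨[], _, _, rfl, .nil, h1, h2⟩
  | cons Y G ih =>
    obtain _ | ⟨h1, h2⟩ := h
    obtain ⟨A, S, B, rfl, hA, hS, hB⟩ := ih h2
    exact ⟨_ :: A, S, B, rfl, .cons h1 hA, hS, hB⟩

/-- Some hypersequent of finite parts of the components is provable in cut-free RK. -/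
def Inconsistent (L : List SignedSet) : Prop :=
  ∃ H, List.Forall₂ Seqt.Sub H L ∧ Deriv cfRK H

theorem inconsistent_append_cons_iff {G K : List SignedSet} {X : SignedSet} :
    Inconsistent (G ++ X :: K) ↔ ∃ A S B, List.Forall₂ Seqt.Sub A G ∧ S.Sub X ∧
      List.Forall₂ Seqt.Sub B K ∧ Deriv cfRK (A ++ S :: B) := by
  constructor
  · rintro ⟨H, h, hd⟩
    obtain ⟨A, S, B, rfl, hA, hS, hB⟩ := exists_of_forall₂_append_cons h
    exact ⟨A, S, B, hA, hS, hB, hd⟩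
  · rintro ⟨A, S, B, hA, hS, hB, hd⟩
    exact ⟨_, List.rel_append hA (.cons hS hB), hd⟩

theorem Inconsistent.append {G : List SignedSet} (h : Inconsistent G) (K : List SignedSet) :
    Inconsistent (G ++ K) := by
  obtain ⟨H, hH, hd⟩ := h
  obtain ⟨B, hB⟩ := exists_forall₂_sub K
  exact ⟨H ++ B, List.rel_append hH hB, hd.append_right_s18 B⟩

theorem Inconsistent.of_insert_true {G K : List SignedSet} {X : SignedSet} {φ : MF}
    (h : Inconsistent (G ++ insert (true, φ) X :: K)) :
    ∃ A Γ Δ B, List.Forall₂ Seqt.Sub A G ∧ Seqt.Sub ⟨Γ, Δ⟩ X ∧ List.Forall₂ Seqt.Sub B K ∧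
      Deriv cfRK (A ++ ⟨φ ::ₘ Γ, Δ⟩ :: B) := by
  classical
  obtain ⟨A, ⟨Γ, Δ⟩, B, hA, hS, hB, hd⟩ := inconsistent_append_cons_iff.1 h
  refine ⟨A, Γ.filter (· ≠ φ), Δ, B, hA, ⟨fun ψ hψ => ?_, fun ψ hψ => ?_⟩, hB,
    hd.incl_component (S := ⟨Γ, Δ⟩) ⟨fun ψ hψ => ?_, fun ψ hψ => hψ⟩⟩
  · have hψ' := Multiset.mem_filter.1 hψ
    simpa [hψ'.2] using hS.1 ψ hψ'.1
  · simpa using hS.2 ψ hψ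
  · by_cases e : ψ = φ
    · simp [e]
    · exact Multiset.mem_cons_of_mem (Multiset.mem_filter.2 ⟨hψ, e⟩)

theorem Inconsistent.of_insert_false {G K : List SignedSet} {X : SignedSet} {φ : MF}
    (h : Inconsistent (G ++ insert (false, φ) X :: K)) :
    ∃ A Γ Δ B, List.Forall₂ Seqt.Sub A G ∧ Seqt.Sub ⟨Γ, Δ⟩ X ∧ List.Forall₂ Seqt.Sub B K ∧
      Deriv cfRK (A ++ ⟨Γ, φ ::ₘ Δ⟩ :: B) := by
  classical
  obtain ⟨A, ⟨Γ, Δ⟩, B, hA, hS, hB, hd⟩ := inconsistent_append_cons_iff.1 h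
  refine ⟨A, Γ, Δ.filter (· ≠ φ), B, hA, ⟨fun ψ hψ => ?_, fun ψ hψ => ?_⟩, hB,
    hd.incl_component (S := ⟨Γ, Δ⟩) ⟨fun ψ hψ => hψ, fun ψ hψ => ?_⟩⟩
  · simpa using hS.1 ψ hψ
  · have hψ' := Multiset.mem_filter.1 hψ
    simpa [hψ'.2] using hS.2 ψ hψ'.1
  · by_cases e : ψ = φ
    · simp [e]
    · exact Multiset.mem_cons_of_mem (Multiset.mem_filter.2 ⟨hψ, e⟩)

theorem Seqt.Sub.cons_ant {Γ Δ : Multiset MF} {X : SignedSet} {φ : MF}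
    (h : Seqt.Sub ⟨Γ, Δ⟩ X) (hφ : (true, φ) ∈ X) : Seqt.Sub ⟨φ ::ₘ Γ, Δ⟩ X :=
  ⟨fun ψ hψ => (Multiset.mem_cons.1 hψ).elim (fun e => e ▸ hφ) (h.1 ψ), h.2⟩

theorem Seqt.Sub.cons_suc {Γ Δ : Multiset MF} {X : SignedSet} {φ : MF}
    (h : Seqt.Sub ⟨Γ, Δ⟩ X) (hφ : (false, φ) ∈ X) : Seqt.Sub ⟨Γ, φ ::ₘ Δ⟩ X :=
  ⟨h.1, fun ψ hψ => (Multiset.mem_cons.1 hψ).elim (fun e => e ▸ hφ) (h.2 ψ)⟩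

/-- Closure of a single component under the propositional rules. -/
structure PropSaturated (X : SignedSet) : Prop where
  not_both : ∀ φ, (true, φ) ∈ X → (false, φ) ∉ X
  neg_true : ∀ φ, (true, .neg φ) ∈ X → (false, φ) ∈ X
  neg_false : ∀ φ, (false, .neg φ) ∈ X → (true, φ) ∈ X
  conj_true : ∀ φ ψ, (true, .conj φ ψ) ∈ X → (true, φ) ∈ X ∧ (true, ψ) ∈ X
  conj_false : ∀ φ ψ, (false, .conj φ ψ) ∈ X → (false, φ) ∈ X ∨ (false, ψ) ∈ X

/-- The condition imposed on consecutive components by the rule `□L`. -/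
def BoxStep (X Y : SignedSet) : Prop := ∀ φ, (true, .box φ) ∈ X → (true, φ) ∈ Y

/-- Closure of a list of components under all rules except `□R`. -/
def Saturated (L : List SignedSet) : Prop :=
  (∀ X ∈ L, PropSaturated X) ∧ L.IsChain BoxStep

theorem Saturated.of_append {G K : List SignedSet} (h : Saturated (G ++ K)) : Saturated G :=
  ⟨fun X hX => h.1 X (List.mem_append_left _ hX), h.2.left_of_append⟩

theorem inconsistent_of_mem_both {G K : List SignedSet} {X : SignedSet} {φ : MF}
    (h1 : (true, φ) ∈ X) (h2 : (false, φ) ∈ X) : Inconsistent (G ++ X :: K) := by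
  obtain ⟨A, hA⟩ := exists_forall₂_sub G
  obtain ⟨B, hB⟩ := exists_forall₂_sub K
  refine inconsistent_append_cons_iff.2
    ⟨A, ⟨{φ}, {φ}⟩, B, hA, ⟨?_, ?_⟩, hB, ((Deriv.ax φ).append_right_s18 B).append_left A⟩
  · simpa using h1
  · simpa using h2

theorem propSaturated_of_maximal {G K : List SignedSet} {X : SignedSet}
    (hc : ¬ Inconsistent (G ++ X :: K))
    (hm : ∀ x, x ∉ X → Inconsistent (G ++ insert x X :: K)) : PropSaturated X where
  not_both φ h1 h2 := hc (inconsistent_of_mem_both h1 h2)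
  neg_true φ h := by
    by_contra hn
    obtain ⟨A, Γ, Δ, B, hA, hS, hB, hd⟩ := (hm _ hn).of_insert_false
    exact hc (inconsistent_append_cons_iff.2
      ⟨A, _, B, hA, hS.cons_ant h, hB, .negL _ _ _ _ _ hd⟩)
  neg_false φ h := by
    by_contra hn
    obtain ⟨A, Γ, Δ, B, hA, hS, hB, hd⟩ := (hm _ hn).of_insert_true
    exact hc (inconsistent_append_cons_iff.2
      ⟨A, _, B, hA, hS.cons_suc h, hB, .negR _ _ _ _ _ hd⟩)
  conj_true φ ψ h := by
    constructor <;> by_contra hn <;>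
      obtain ⟨A, Γ, Δ, B, hA, hS, hB, hd⟩ := (hm _ hn).of_insert_true
    · exact hc (inconsistent_append_cons_iff.2
        ⟨A, _, B, hA, hS.cons_ant h, hB, .andL1 _ _ _ _ _ _ hd⟩)
    · exact hc (inconsistent_append_cons_iff.2
        ⟨A, _, B, hA, hS.cons_ant h, hB, .andL2 _ _ _ _ _ _ hd⟩)
  conj_false φ ψ h := by
    by_contra! hn
    obtain ⟨A, Γ, Δ, B, hA, hS, hB, hd⟩ := (hm _ hn.1).of_insert_false
    obtain ⟨A', Γ', Δ', B', hA', hS', hB', hd'⟩ := (hm _ hn.2).of_insert_false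
    obtain ⟨A₀, hA₀, hAA, hAA'⟩ := exists_forall₂_sub_join hA hA'
    obtain ⟨B₀, hB₀, hBB, hBB'⟩ := exists_forall₂_sub_join hB hB'
    have hS₀ : Seqt.Sub ⟨Γ + Γ', Δ + Δ'⟩ X :=
      ⟨fun χ hχ => (Multiset.mem_add.1 hχ).elim (hS.1 χ) (hS'.1 χ),
        fun χ hχ => (Multiset.mem_add.1 hχ).elim (hS.2 χ) (hS'.2 χ)⟩
    refine hc (inconsistent_append_cons_iff.2
      ⟨A₀, _, B₀, hA₀, hS₀.cons_suc h, hB₀, .andR _ _ _ _ _ _ ?_ ?_⟩)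
    · refine hd.incl (List.rel_append hAA (.cons ⟨fun χ hχ => ?_, fun χ hχ => ?_⟩ hBB))
      · exact Multiset.mem_add.2 (.inl hχ)
      · simp only [Multiset.mem_cons, Multiset.mem_add] at hχ ⊢
        tauto
    · refine hd'.incl (List.rel_append hAA' (.cons ⟨fun χ hχ => ?_, fun χ hχ => ?_⟩ hBB'))
      · exact Multiset.mem_add.2 (.inr hχ)
      · simp only [Multiset.mem_cons, Multiset.mem_add] at hχ ⊢
        tauto

theorem boxStep_of_maximal {G K : List SignedSet} {X Y : SignedSet}
    (hc : ¬ Inconsistent (G ++ X :: Y :: K))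
    (hm : ∀ x, x ∉ Y → Inconsistent (G ++ X :: insert x Y :: K)) : BoxStep X Y := by
  intro φ h
  by_contra hn
  have hi : Inconsistent ((G ++ [X]) ++ insert (true, φ) Y :: K) := by simpa using hm _ hn
  obtain ⟨A, Λ, Θ, B, hA, hT, hB, hd⟩ := hi.of_insert_true
  obtain ⟨A, ⟨Γ, Δ⟩, A', rfl, hAG, hS, hA'⟩ := exists_of_forall₂_append_cons hA
  cases hA'
  refine hc (inconsistent_append_cons_iff.2
    ⟨A, _, ⟨Λ, Θ⟩ :: B, hAG, hS.cons_ant h, .cons hT hB, .boxL _ _ _ _ _ _ _ ?_⟩)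
  simpa using hd

open Order in
theorem exists_maximal_component {G K : List SignedSet} {X : SignedSet}
    (hc : ¬ Inconsistent (G ++ X :: K)) :
    ∃ Y, X ⊆ Y ∧ ¬ Inconsistent (G ++ Y :: K) ∧
      ∀ x, x ∉ Y → Inconsistent (G ++ insert x Y :: K) := by
  have hF : IsOfFiniteCharacter {Y : SignedSet | ¬ Inconsistent (G ++ Y :: K)} := by
    intro Y
    constructor
    · intro hY Z hZ _ hi
      obtain ⟨A, S, B, hA, hS, hB, hd⟩ := inconsistent_append_cons_iff.1 hi
      exact hY (inconsistent_append_cons_iff.2 ⟨A, S, B, hA, hS.mono hZ, hB, hd⟩)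
    · intro h hi
      obtain ⟨A, S, B, hA, hS, hB, hd⟩ := inconsistent_append_cons_iff.1 hi
      exact h S.toSigned (Seqt.toSigned_subset hS) S.finite_toSigned
        (inconsistent_append_cons_iff.2 ⟨A, S, B, hA, S.sub_toSigned, hB, hd⟩)
  obtain ⟨Y, hXY, hY⟩ := hF.exists_maximal hc
  refine ⟨Y, hXY, hY.prop, fun x hx => ?_⟩
  by_contra hn
  exact hx (hY.le_of_ge hn (Set.subset_insert x Y) (Set.mem_insert x Y))

theorem exists_saturated_component {G K : List SignedSet} {X : SignedSet} (hG : Saturated G)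
    (hc : ¬ Inconsistent (G ++ X :: K)) :
    ∃ Y, X ⊆ Y ∧ ¬ Inconsistent (G ++ Y :: K) ∧ Saturated (G ++ [Y]) := by
  obtain ⟨Y, hXY, hY, hm⟩ := exists_maximal_component hc
  refine ⟨Y, hXY, hY, ?_, ?_⟩
  · intro Z hZ
    rcases List.mem_append.1 hZ with hZ | hZ
    · exact hG.1 Z hZ
    · rw [List.mem_singleton.1 hZ]
      exact propSaturated_of_maximal hY hm
  · rcases List.eq_nil_or_concat G with rfl | ⟨G, Z, rfl⟩
    · simp
    · simp only [List.concat_eq_append, List.append_assoc, List.cons_append,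
        List.nil_append] at hG hY hm ⊢
      exact List.isChain_append_cons_cons.2 ⟨hG.2, boxStep_of_maximal hY hm, by simp⟩

theorem exists_saturated_extension {G : List SignedSet} (hG : Saturated G)
    (K : List SignedSet) (hc : ¬ Inconsistent (G ++ K)) :
    ∃ L, List.Forall₂ (· ⊆ ·) K L ∧ ¬ Inconsistent (G ++ L) ∧ Saturated (G ++ L) := by
  induction K generalizing G with
  | nil => exact ⟨[], .nil, hc, by simpa using hG⟩
  | cons X K ih =>
    obtain ⟨Y, hXY, hY, hs⟩ := exists_saturated_component hG hc
    obtain ⟨L, hL, hcL, hsL⟩ := ih hs (by simpa using hY)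
    exact ⟨Y :: L, .cons hXY hL, by simpa using hcL, by simpa using hsL⟩

/-- The canonical model: worlds are saturated consistent lists of components, and the
accessible worlds are the extensions by one component. -/
def canonicalModel : KModel where
  W := {L : List SignedSet // Saturated L ∧ ¬ Inconsistent L}
  R v w := ∃ X, w.1 = v.1 ++ [X]
  V n w := ∃ X, w.1.getLast? = some X ∧ (true, .atom n) ∈ X

theorem exists_box_witness {G : List SignedSet} {X : SignedSet} {φ : MF}
    (hs : Saturated (G ++ [X])) (hc : ¬ Inconsistent (G ++ [X])) (h : (false, .box φ) ∈ X) :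
    ∃ Y, (false, φ) ∈ Y ∧ ¬ Inconsistent (G ++ [X] ++ [Y]) ∧
      Saturated (G ++ [X] ++ [Y]) := by
  have hc' : ¬ Inconsistent (G ++ [X] ++ [{(false, φ)}]) := by
    intro hi
    obtain ⟨A, T, B, hA, hT, hB, hd⟩ := inconsistent_append_cons_iff.1 hi
    obtain ⟨A, ⟨Γ, Δ⟩, A', rfl, hAG, hS, hA'⟩ := exists_of_forall₂_append_cons hA
    cases hA'
    cases hB
    refine hc (inconsistent_append_cons_iff.2
      ⟨A, _, [], hAG, hS.cons_suc h, .nil, .boxR _ _ _ _ ?_⟩)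
    have hT' : T.Incl ⟨0, {φ}⟩ :=
      ⟨fun ψ hψ => by simpa using hT.1 ψ hψ, fun ψ hψ => by simpa using hT.2 ψ hψ⟩
    simpa using hd.incl_component hT'
  obtain ⟨Y, hY, hcY, hsY⟩ := exists_saturated_component hs hc'
  exact ⟨Y, hY rfl, hcY, hsY⟩

theorem canonicalModel_truth (φ : MF) (w : canonicalModel.W) {G : List SignedSet}
    {X : SignedSet} (hw : w.1 = G ++ [X]) :
    ((true, φ) ∈ X → canonicalModel.sat w φ) ∧
      ((false, φ) ∈ X → ¬ canonicalModel.sat w φ) := by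
  have hX : PropSaturated X := w.2.1.1 X (by simp [hw])
  induction φ generalizing w G X with
  | atom n =>
    have hV : canonicalModel.sat w (.atom n) ↔ (true, .atom n) ∈ X := by
      simp [KModel.sat, canonicalModel, hw]
    rw [hV]
    exact ⟨id, fun h h' => hX.not_both _ h' h⟩
  | neg φ ih =>
    have := ih w hw hX
    exact ⟨fun h => this.2 (hX.neg_true _ h), fun h hn => hn (this.1 (hX.neg_false _ h))⟩
  | conj φ ψ ih1 ih2 =>
    have h1 := ih1 w hw hX
    have h2 := ih2 w hw hX
    refine ⟨fun h => ⟨h1.1 (hX.conj_true _ _ h).1, h2.1 (hX.conj_true _ _ h).2⟩, fun h hn => ?_⟩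
    exact (hX.conj_false _ _ h).elim (fun h => h1.2 h hn.1) (fun h => h2.2 h hn.2)
  | box φ ih =>
    constructor
    · rintro h v ⟨Y, hv⟩
      refine (ih v hv (v.2.1.1 Y (by simp [hv]))).1 ?_
      have hch := v.2.1.2
      rw [hv, hw, List.append_assoc] at hch
      exact (List.isChain_append_cons_cons.1 hch).2.1 φ h
    · intro h hbox
      have hw2 := w.2
      rw [hw] at hw2
      obtain ⟨Y, hφ, hcY, hsY⟩ := exists_box_witness hw2.1 hw2.2 h
      let v : canonicalModel.W := ⟨G ++ [X] ++ [Y], hsY, hcY⟩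
      exact (ih v rfl (hsY.1 Y (by simp))).2 hφ (hbox v ⟨Y, by rw [hw]⟩)

theorem exists_canonical_branch (G K : List SignedSet) (hs : Saturated (G ++ K))
    (hc : ¬ Inconsistent (G ++ K)) :
    ∃ ws : List canonicalModel.W, ws.IsChain canonicalModel.R ∧
      List.Forall₂ (fun X w => ∃ G', w.1 = G' ++ [X]) K ws ∧
      ∀ w ∈ ws.head?, ∃ X, w.1 = G ++ [X] := by
  induction K generalizing G with
  | nil => exact ⟨[], .nil, .nil, by simp⟩
  | cons X K ih =>
    have e : G ++ X :: K = G ++ [X] ++ K := by simp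
    rw [e] at hs hc
    obtain ⟨ws, h1, h2, h3⟩ := ih (G ++ [X]) hs hc
    let w : canonicalModel.W := ⟨G ++ [X], hs.of_append, fun hi => hc (hi.append K)⟩
    exact ⟨w :: ws, List.isChain_cons.2 ⟨h3, h1⟩, .cons ⟨G, rfl⟩ h2,
      by simpa using ⟨X, rfl⟩⟩

/-- Cut-free completeness of RK: every hypersequent not provable in cut-free RK
has a Kripke counter-example (equivalently, every hypersequent valid over the
class of all Kripke frames is provable in RK without cut). -/
theorem cut_free_completeness_RK (H : Hyperseq) (hne : H ≠ [])
    (h : ¬ Deriv cfRK H) : ∃ M : KModel, CounterExample M H := by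
  have hc : ¬ Inconsistent ([] ++ H.map Seqt.toSigned) := by
    rintro ⟨H', hH', hd⟩
    rw [List.nil_append, List.forall₂_map_right_iff] at hH'
    exact h (hd.incl (hH'.imp fun _ _ hS => hS.incl))
  obtain ⟨L, hL, hcL, hsL⟩ := exists_saturated_extension ⟨by simp, .nil⟩ _ hc
  obtain ⟨ws, hch, hws, -⟩ := exists_canonical_branch [] L hsL hcL
  rw [List.forall₂_map_left_iff] at hL
  refine ⟨canonicalModel, ws, hch, ?_⟩
  clear hc hcL hsL hch h hne
  induction hL generalizing ws with
  | nil => cases hws; exact .nil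
  | @cons S X H L hSX _ ih =>
    obtain _ | ⟨⟨G, hw⟩, hws⟩ := hws
    have hS := S.sub_toSigned.mono hSX
    exact .cons ⟨fun φ hφ => (canonicalModel_truth φ _ hw).1 (hS.1 φ hφ),
      fun φ hφ => (canonicalModel_truth φ _ hw).2 (hS.2 φ hφ)⟩ (ih _ hws)
end
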